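/- arXiv:2503.07671 — 7 statements merged into one kernel-verified Lean document; each statement's English description precedes it below -/
import Mathlib

section
/- Let X be a measurable space, let κ be a Markov kernel from X to X, let η : X → ℝ be a measurable function with 0 ≤ η(x) ≤ 1 for all x ∈ X, and let T ⊆ X be a measurable set such that η(x) = 1 for every x ∈ T and such that ∫ η(y) dκ(x)(y) ≤ η(x) for every x ∈ X. Then for every x₀ ∈ X, the trajectory measure μ_{x₀} satisfies μ_{x₀}({ω : ℕ → X | ∃ n, ω n ∈ T}) ≤ η(x₀). -/
open MeasureTheory ProbabilityTheory
open scoped ENNReal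

/-- `cylWeight κ A m k x` is the probability that the time-homogeneous Markov chain with
transition kernel `κ`, currently at `x` (time `k`), has its next `m` coordinates in
`A (k+1), …, A (k+m)`. -/
noncomputable def cylWeight {X : Type*} [MeasurableSpace X] (κ : Kernel X X)
    (A : ℕ → Set X) : ℕ → ℕ → X → ℝ≥0∞
  | 0, _, _ => 1
  | m + 1, k, x => ∫⁻ y in A (k + 1), cylWeight κ A m (k + 1) y ∂(κ x)

/-- If `f` is superharmonic for the Markov kernel `κ` and at least `1` on `T`, then the probability
of avoiding `T` during the next `m` steps from `x` is at least `1 - f x`. -/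
lemma one_le_cylWeight_compl_add {X : Type*} [MeasurableSpace X] (κ : Kernel X X)
    [IsMarkovKernel κ] {f : X → ℝ≥0∞} (hf : Measurable f) {T : Set X} (hT : MeasurableSet T)
    (hfT : ∀ x ∈ T, 1 ≤ f x) (hdec : ∀ x, ∫⁻ y, f y ∂(κ x) ≤ f x) (m k : ℕ) (x : X) :
    1 ≤ cylWeight κ (fun _ => Tᶜ) m k x + f x := by
  induction m generalizing k x with
  | zero => simp [cylWeight]
  | succ m ih =>
    calc (1 : ℝ≥0∞) = ∫⁻ _, 1 ∂(κ x) := by simp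
      _ = ∫⁻ _ in T, 1 ∂(κ x) + ∫⁻ _ in Tᶜ, 1 ∂(κ x) := (lintegral_add_compl _ hT).symm
      _ ≤ ∫⁻ y in T, f y ∂(κ x)
          + ∫⁻ y in Tᶜ, (cylWeight κ (fun _ => Tᶜ) m (k + 1) y + f y) ∂(κ x) :=
        add_le_add (setLIntegral_mono hf hfT) (lintegral_mono fun y => ih (k + 1) y)
      _ = cylWeight κ (fun _ => Tᶜ) (m + 1) k x
          + (∫⁻ y in T, f y ∂(κ x) + ∫⁻ y in Tᶜ, f y ∂(κ x)) := by
        rw [lintegral_add_right _ hf, cylWeight, add_left_comm]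
      _ ≤ cylWeight κ (fun _ => Tᶜ) (m + 1) k x + f x := by
        rw [lintegral_add_compl _ hT]
        exact add_le_add_right (hdec x) _

/-- Theorem 1 (safety guarantee), measure-theoretic form.  Let `κ` be a Markov kernel on
`X`, and for `x₀ : X` let `μ x₀` be the trajectory measure of the Markov chain with
transition kernel `κ` started at `x₀` (characterized on cylinder sets by `hcyl`, as given
by the Ionescu–Tulcea construction).  If `η : X → ℝ` is measurable with `0 ≤ η ≤ 1`,
`η = 1` on a measurable set `T`, and `∫ η dκ(x) ≤ η x` for every `x`, then the
probability that the chain ever visits `T` is at most `η x₀`. -/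
theorem safety_guarantee {X : Type*} [MeasurableSpace X]
    (κ : Kernel X X) [IsMarkovKernel κ]
    (μ : X → Measure (ℕ → X))
    (hprob : ∀ x, IsProbabilityMeasure (μ x))
    (hcyl : ∀ (x : X) (n : ℕ) (A : ℕ → Set X), (∀ i, MeasurableSet (A i)) →
      μ x {ω | ∀ i ≤ n, ω i ∈ A i} =
        Set.indicator (A 0) (fun _ => cylWeight κ A n 0 x) x)
    (η : X → ℝ) (hηm : Measurable η)
    (hη0 : ∀ x, 0 ≤ η x) (hη1 : ∀ x, η x ≤ 1)
    (T : Set X) (hT : MeasurableSet T) (hηT : ∀ x ∈ T, η x = 1)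
    (hdec : ∀ x, ∫ y, η y ∂(κ x) ≤ η x)
    (x₀ : X) :
    μ x₀ {ω | ∃ n : ℕ, ω n ∈ T} ≤ ENNReal.ofReal (η x₀) := by
  have := hprob x₀
  by_cases hx : x₀ ∈ T
  · simpa [hηT x₀ hx] using prob_le_one (μ := μ x₀)
  have hdec' : ∀ x, ∫⁻ y, ENNReal.ofReal (η y) ∂(κ x) ≤ ENNReal.ofReal (η x) := fun x => by
    have hint : Integrable η (κ x) :=
      .of_bound hηm.aestronglyMeasurable 1
        (ae_of_all _ fun y => by simpa [abs_of_nonneg (hη0 y)] using hη1 y)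
    rw [← ofReal_integral_eq_lintegral_ofReal hint (ae_of_all _ hη0)]
    exact ENNReal.ofReal_le_ofReal (hdec x)
  have hunion : {ω : ℕ → X | ∃ n, ω n ∈ T} = ⋃ n, {ω | ∀ i ≤ n, ω i ∈ Tᶜ}ᶜ := by
    ext ω
    simp only [Set.mem_ofPred_eq, Set.mem_iUnion, Set.mem_compl_iff, not_forall, not_not]
    exact ⟨fun ⟨n, hn⟩ => ⟨n, n, le_rfl, hn⟩, fun ⟨_, i, _, hi⟩ => ⟨i, hi⟩⟩
  have hmono : Monotone fun n => {ω : ℕ → X | ∀ i ≤ n, ω i ∈ Tᶜ}ᶜ := fun _ _ hmn =>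
    Set.compl_subset_compl.2 fun _ hω i hi => hω i (hi.trans hmn)
  rw [hunion, hmono.measure_iUnion]
  refine iSup_le fun n => ?_
  have hmeas : MeasurableSet {ω : ℕ → X | ∀ i ≤ n, ω i ∈ Tᶜ} := by
    simp only [Set.ofPred_forall]
    exact .iInter fun i => .iInter fun _ => measurable_pi_apply i hT.compl
  rw [prob_compl_eq_one_sub hmeas, hcyl x₀ n (fun _ => Tᶜ) fun _ => hT.compl,
    Set.indicator_of_mem (by exact hx), tsub_le_iff_left]
  exact one_le_cylWeight_compl_add κ hηm.ennreal_ofReal hT (fun x hx => by simp [hηT x hx])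
    hdec' n 0 x₀
end

section
/- Let S be a nonempty finite set (equipped with the discrete σ-algebra), let P : S → S → ℝ be a row-stochastic matrix, let κ be the associated Markov kernel (κ(s) is the probability measure on S with κ(s)({s'}) = P s s'), and let T ⊆ S. Define ω : ℕ → S → ℝ by ω 0 s = 1 if s ∈ T and ω 0 s = 0 otherwise, and ω (n+1) s = 1 if s ∈ T and ω (n+1) s = Σ_{s' ∈ S} P s s' · ω n s' otherwise. Then for every n ∈ ℕ and every s ∈ S, ω n s equals μ_s({ζ : ℕ → S | ∃ i ≤ n, ζ i ∈ T}), where μ_s is the trajectory measure of the chain started at s. -/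
open MeasureTheory Finset
open scoped ENNReal Classical

/-- The bounded-reachability iterates: `omegaIter P T n s` is the probability that the
Markov chain with transition matrix `P` started at `s` visits `T` within `n` steps. -/
noncomputable def omegaIter {S : Type*} [Fintype S] (P : S → S → ℝ) (T : Set S) :
    ℕ → S → ℝ
  | 0, s => if s ∈ T then 1 else 0
  | n + 1, s => if s ∈ T then 1 else ∑ s' : S, P s s' * omegaIter P T n s'

/-- The iterates of the bounded-reachability recursion are nonnegative. -/
theorem omegaIter_nonneg {S : Type*} [Fintype S] {P : S → S → ℝ} (hP0 : ∀ s s', 0 ≤ P s s')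
    (T : Set S) (n : ℕ) (s : S) : 0 ≤ omegaIter P T n s := by
  induction n generalizing s with
  | zero => unfold omegaIter; split_ifs <;> simp
  | succ n ih =>
    unfold omegaIter
    split_ifs
    · exact zero_le_one
    · exact Finset.sum_nonneg fun s' _ => mul_nonneg (hP0 s s') (ih s')

/-- A measure with Markovian cylinder probabilities gives an event depending on the first `n + 1`
coordinates the total weight of its paths. -/
theorem measure_path_mem_eq_sum {S : Type*} [Fintype S] [DecidableEq S]
    [MeasurableSpace S] [MeasurableSingletonClass S] {P : S → S → ℝ} {s : S}
    {ν : Measure (ℕ → S)}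
    (hcyl : ∀ (n : ℕ) (a : ℕ → S),
      ν {ζ | ∀ i ≤ n, ζ i = a i} =
        (if a 0 = s then 1 else 0) *
          ∏ i ∈ Finset.range n, ENNReal.ofReal (P (a i) (a (i + 1))))
    (n : ℕ) (B : Set (Fin (n + 1) → S)) :
    ν {ζ | (fun i : Fin (n + 1) => ζ i) ∈ B} =
      ∑ a : Fin (n + 1) → S, if a ∈ B then (if a 0 = s then 1 else 0) *
        ∏ i : Fin n, ENNReal.ofReal (P (a i.castSucc) (a i.succ)) else 0 := by
  have hmeas : Measurable fun (ζ : ℕ → S) (i : Fin (n + 1)) => ζ i := by fun_prop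
  have hsum := sum_measure_preimage_singleton (μ := ν) (Finset.univ.filter (· ∈ B))
    (f := fun (ζ : ℕ → S) (i : Fin (n + 1)) => ζ i) fun a _ => hmeas (measurableSet_singleton a)
  rw [Finset.coe_filter_univ] at hsum
  change ν ((fun (ζ : ℕ → S) (i : Fin (n + 1)) => ζ i) ⁻¹' {a | a ∈ B}) = _
  rw [← hsum, Finset.sum_filter]
  refine Finset.sum_congr rfl fun a _ => if_congr Iff.rfl ?_ rfl
  have hset : (fun (ζ : ℕ → S) (i : Fin (n + 1)) => ζ i) ⁻¹' {a} =
      {ζ | ∀ i ≤ n, ζ i = a (Fin.ofNat (n + 1) i)} := by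
    ext ζ
    simp only [Set.mem_preimage, Set.mem_singleton_iff, funext_iff, Set.mem_ofPred_eq]
    constructor
    · intro h i hi
      have := h (Fin.ofNat (n + 1) i)
      rwa [Fin.val_ofNat, Nat.mod_eq_of_lt (Nat.lt_succ_of_le hi)] at this
    · intro h i
      rw [h i (Nat.le_of_lt_succ i.2), Fin.ofNat_val_eq_self]
  rw [hset, hcyl n fun i => a (Fin.ofNat (n + 1) i), Finset.prod_range]
  congr 1
  refine Finset.prod_congr rfl fun i _ => ?_
  have h₁ : Fin.ofNat (n + 1) i = i.castSucc := by
    ext; simp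
  have h₂ : Fin.ofNat (n + 1) (i + 1) = i.succ := by
    ext; simp
  rw [h₁, h₂]

/-- The Markov property at time one, for events depending on finitely many coordinates. -/
theorem measure_shift_path_mem_eq_sum {S : Type*} [Fintype S] [DecidableEq S]
    [MeasurableSpace S] [MeasurableSingletonClass S] {P : S → S → ℝ}
    {μ : S → Measure (ℕ → S)}
    (hcyl : ∀ (s : S) (n : ℕ) (a : ℕ → S),
      μ s {ζ | ∀ i ≤ n, ζ i = a i} =
        (if a 0 = s then 1 else 0) *
          ∏ i ∈ Finset.range n, ENNReal.ofReal (P (a i) (a (i + 1))))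
    (s : S) (n : ℕ) (B : Set (Fin (n + 1) → S)) :
    μ s {ζ | (fun i : Fin (n + 1) => ζ (i + 1)) ∈ B} =
      ∑ s', ENNReal.ofReal (P s s') * μ s' {ζ | (fun i : Fin (n + 1) => ζ i) ∈ B} := by
  have hshift := measure_path_mem_eq_sum (hcyl s) (n + 1) {a | Fin.tail a ∈ B}
  change μ s {ζ | (fun i : Fin (n + 1) => ζ (i + 1)) ∈ B} = _ at hshift
  rw [hshift, ← (Fin.consEquiv fun _ : Fin (n + 2) => S).sum_comp, Fintype.sum_prod_type_right]
  simp_rw [measure_path_mem_eq_sum (hcyl _) n B, Finset.mul_sum]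
  rw [Finset.sum_comm (s := (Finset.univ : Finset S))]
  refine Finset.sum_congr rfl fun b _ => ?_
  by_cases hb : b ∈ B
  · simp [hb, Fin.prod_univ_succ, Fin.consEquiv]
  · simp [hb, Fin.consEquiv]

/-- Equation (1) in the proof of Theorem 1: for a row-stochastic matrix `P` on a nonempty
finite set `S` (with the discrete σ-algebra) and the trajectory measures `μ s` of the
associated Markov chain started at `s` (characterized by their finite-dimensional
distributions `hcyl`, as given by the Ionescu–Tulcea construction applied to the kernel
`κ` with `κ s {s'} = P s s'`), the `n`-th iterate of the bounded-reachability recursion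
equals the probability of hitting `T` within `n` steps. -/
theorem omegaIter_eq_prob {S : Type*} [Fintype S] [DecidableEq S] [Nonempty S]
    [MeasurableSpace S] [MeasurableSingletonClass S]
    (P : S → S → ℝ)
    (hP0 : ∀ s s', 0 ≤ P s s') (hP1 : ∀ s, ∑ s' : S, P s s' = 1)
    (T : Set S)
    (μ : S → Measure (ℕ → S))
    (hprob : ∀ s, IsProbabilityMeasure (μ s))
    (hcyl : ∀ (s : S) (n : ℕ) (a : ℕ → S),
      μ s {ζ | ∀ i ≤ n, ζ i = a i} =
        (if a 0 = s then 1 else 0) *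
          ∏ i ∈ Finset.range n, ENNReal.ofReal (P (a i) (a (i + 1)))) :
    ∀ (n : ℕ) (s : S),
      ENNReal.ofReal (omegaIter P T n s) = μ s {ζ | ∃ i ≤ n, ζ i ∈ T} := by
  intro n
  have hstart : ∀ s, ∀ᵐ ζ ∂μ s, ζ 0 = s := by
    intro s
    have := hprob s
    have hmeas : MeasurableSet {ζ : ℕ → S | ζ 0 = s} :=
      measurableSet_eq_fun (measurable_pi_apply 0) measurable_const
    refine (mem_ae_iff_prob_eq_one hmeas).2 ?_
    simpa using hcyl s 0 fun _ => s
  have hmem : ∀ n s, s ∈ T → μ s {ζ | ∃ i ≤ n, ζ i ∈ T} = 1 := by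
    intro n s hs
    have := hprob s
    rw [← measure_univ (μ := μ s)]
    refine measure_congr ?_
    filter_upwards [hstart s] with ζ hζ
    exact propext ⟨fun _ => trivial, fun _ => ⟨0, n.zero_le, by rwa [hζ]⟩⟩
  induction n with
  | zero =>
    intro s
    by_cases hs : s ∈ T
    · rw [hmem 0 s hs, omegaIter, if_pos hs, ENNReal.ofReal_one]
    · simp only [omegaIter, hs, if_false, ENNReal.ofReal_zero]
      symm
      refine measure_eq_zero_iff_ae_notMem.2 ?_
      filter_upwards [hstart s] with ζ hζ
      rintro ⟨i, hi, hiT⟩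
      rw [Nat.le_zero.1 hi, hζ] at hiT
      exact hs hiT
  | succ n ih =>
    intro s
    by_cases hs : s ∈ T
    · rw [hmem (n + 1) s hs, omegaIter, if_pos hs, ENNReal.ofReal_one]
    · have hpath : ∀ ζ : ℕ → S, (∃ i ≤ n, ζ i ∈ T) ↔
          (fun i : Fin (n + 1) => ζ i) ∈ {a : Fin (n + 1) → S | ∃ i, a i ∈ T} := fun ζ =>
        ⟨fun ⟨i, hi, h⟩ => ⟨⟨i, Nat.lt_succ_of_le hi⟩, h⟩,
          fun ⟨i, h⟩ => ⟨i, Nat.le_of_lt_succ i.2, h⟩⟩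
      have hstep : μ s {ζ | ∃ i ≤ n + 1, ζ i ∈ T} =
          μ s {ζ | (fun i : Fin (n + 1) => ζ (i + 1)) ∈
            {a : Fin (n + 1) → S | ∃ i, a i ∈ T}} := by
        refine measure_congr ?_
        filter_upwards [hstart s] with ζ hζ
        refine propext (Iff.trans ?_ (hpath fun i => ζ (i + 1)))
        constructor
        · rintro ⟨_ | i, hi, h⟩
          · exact absurd (hζ ▸ h) hs
          · exact ⟨i, Nat.le_of_succ_le_succ hi, h⟩
        · rintro ⟨i, hi, h⟩
          exact ⟨i + 1, Nat.succ_le_succ hi, h⟩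
      rw [hstep, measure_shift_path_mem_eq_sum hcyl]
      simp only [omegaIter, hs, if_false]
      rw [ENNReal.ofReal_sum_of_nonneg fun s' _ =>
        mul_nonneg (hP0 s s') (omegaIter_nonneg hP0 T n s')]
      refine Finset.sum_congr rfl fun s' _ => ?_
      rw [ENNReal.ofReal_mul (hP0 s s'), ih s']
      simp_rw [hpath]
end

section
/- Let S be a nonempty finite set (equipped with the discrete σ-algebra), let P : S → S → ℝ be a row-stochastic matrix with associated Markov kernel κ, let T ⊆ S, and let η : S → ℝ satisfy 0 ≤ η(s) ≤ 1 for all s ∈ S, η(s) = 1 for every s ∈ T, and Σ_{s' ∈ S} P s s' · η(s') ≤ η(s) for every s ∈ S. Then for every s ∈ S, μ_s({ζ : ℕ → S | ∃ i, ζ i ∈ T}) ≤ η(s), where μ_s is the trajectory measure of the chain started at s. -/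
open MeasureTheory Finset
open scoped ENNReal

/-- If the cylinder probabilities of `ν` factor through the transition weights `p`, and `f` is
superharmonic for `p` and at least `1` on `T`, then the probability of following `a` up to time `n`
and visiting `T` within the next `k` steps is at most `f (a n)` times that of the cylinder. -/
theorem measure_cylinder_inter_reach_le {S : Type*} [Fintype S] [DecidableEq S]
    [MeasurableSpace S] {p : S → S → ℝ≥0∞} {T : Set S} {f : S → ℝ≥0∞}
    (hfT : ∀ s ∈ T, 1 ≤ f s) (hf : ∀ s, ∑ s', p s s' * f s' ≤ f s)
    {ν : Measure (ℕ → S)}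
    (hν : ∀ (n : ℕ) (a : ℕ → S), ν {ζ | ∀ i ≤ n + 1, ζ i = a i} =
      ν {ζ | ∀ i ≤ n, ζ i = a i} * p (a n) (a (n + 1)))
    (k n : ℕ) (a : ℕ → S) :
    ν {ζ | (∀ i ≤ n, ζ i = a i) ∧ ∃ i, n ≤ i ∧ i ≤ n + k ∧ ζ i ∈ T} ≤
      ν {ζ | ∀ i ≤ n, ζ i = a i} * f (a n) := by
  induction k generalizing n a with
  | zero =>
    by_cases ha : a n ∈ T
    · exact (measure_mono fun ζ hζ => hζ.1).trans (le_mul_of_one_le_right' (hfT _ ha))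
    · have hempty : {ζ : ℕ → S | (∀ i ≤ n, ζ i = a i) ∧ ∃ i, n ≤ i ∧ i ≤ n + 0 ∧ ζ i ∈ T} = ∅ := by
        ext ζ
        simp only [Set.mem_ofPred_eq, Set.mem_empty_iff_false, iff_false]
        rintro ⟨h, i, h1, h2, hT⟩
        obtain rfl : i = n := by omega
        exact ha (h i le_rfl ▸ hT)
      rw [hempty, measure_empty]
      exact zero_le
  | succ k ih =>
    by_cases ha : a n ∈ T
    · exact (measure_mono fun ζ hζ => hζ.1).trans (le_mul_of_one_le_right' (hfT _ ha))
    let b : S → ℕ → S := fun s' => Function.update a (n + 1) s'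
    have hb (s' : S) (i : ℕ) (hi : i ≤ n) : b s' i = a i :=
      Function.update_of_ne (by omega) _ _
    have hb' (s' : S) : b s' (n + 1) = s' := Function.update_self _ _ _
    have hcyl (s' : S) : ν {ζ | ∀ i ≤ n + 1, ζ i = b s' i} =
        ν {ζ | ∀ i ≤ n, ζ i = a i} * p (a n) s' := by
      rw [hν, hb', hb s' n le_rfl]
      congr 3
      ext ζ
      exact forall₂_congr fun i hi => by rw [hb s' i hi]
    calc _ ≤ ν (⋃ s', {ζ | (∀ i ≤ n + 1, ζ i = b s' i) ∧
              ∃ i, n + 1 ≤ i ∧ i ≤ n + 1 + k ∧ ζ i ∈ T}) := by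
          refine measure_mono ?_
          rintro ζ ⟨h, i, h1, h2, hT⟩
          refine Set.mem_iUnion.2 ⟨ζ (n + 1), fun j hj => ?_, i, ?_, by omega, hT⟩
          · rcases Nat.le_succ_iff.1 hj with hj | rfl
            · rw [hb _ j hj, h j hj]
            · exact (hb' _).symm
          · refine Nat.lt_of_le_of_ne h1 ?_
            rintro rfl
            exact ha (h n le_rfl ▸ hT)
      _ ≤ ∑ s', ν {ζ | (∀ i ≤ n + 1, ζ i = b s' i) ∧
              ∃ i, n + 1 ≤ i ∧ i ≤ n + 1 + k ∧ ζ i ∈ T} := measure_iUnion_fintype_le _ _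
      _ ≤ ∑ s', ν {ζ | ∀ i ≤ n + 1, ζ i = b s' i} * f (b s' (n + 1)) :=
          Finset.sum_le_sum fun s' _ => ih (n + 1) (b s')
      _ = ν {ζ | ∀ i ≤ n, ζ i = a i} * ∑ s', p (a n) s' * f s' := by
          simp only [hcyl, hb', Finset.mul_sum, mul_assoc]
      _ ≤ _ := by gcongr; exact hf _

/-- Theorem 1 (safety guarantee) in finite-state Markov-chain form: for a row-stochastic
matrix `P` on a nonempty finite set `S` (with the discrete σ-algebra) and the trajectory
measures `μ s` of the associated Markov chain started at `s` (characterized by their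
finite-dimensional distributions `hcyl`, as given by the Ionescu–Tulcea construction
applied to the kernel `κ` with `κ s {s'} = P s s'`), any function `η` with values in
`[0,1]` that equals `1` on `T` and is a pointwise pre-fixed point of the one-step
expectation operator is an upper bound on the probability of ever reaching `T`. -/
theorem prob_reach_le_eta {S : Type*} [Fintype S] [DecidableEq S] [Nonempty S]
    [MeasurableSpace S] [MeasurableSingletonClass S]
    (P : S → S → ℝ)
    (hP0 : ∀ s s', 0 ≤ P s s') (hP1 : ∀ s, ∑ s' : S, P s s' = 1)
    (T : Set S)
    (η : S → ℝ) (hη0 : ∀ s, 0 ≤ η s) (hη1 : ∀ s, η s ≤ 1)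
    (hηT : ∀ s ∈ T, η s = 1)
    (hpre : ∀ s, ∑ s' : S, P s s' * η s' ≤ η s)
    (μ : S → Measure (ℕ → S))
    (hprob : ∀ s, IsProbabilityMeasure (μ s))
    (hcyl : ∀ (s : S) (n : ℕ) (a : ℕ → S),
      μ s {ζ | ∀ i ≤ n, ζ i = a i} =
        (if a 0 = s then 1 else 0) *
          ∏ i ∈ Finset.range n, ENNReal.ofReal (P (a i) (a (i + 1)))) :
    ∀ s : S, μ s {ζ | ∃ i : ℕ, ζ i ∈ T} ≤ ENNReal.ofReal (η s) := by
  intro s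
  have hreach (k : ℕ) : μ s {ζ | ∃ i ≤ k, ζ i ∈ T} ≤ ENNReal.ofReal (η s) := by
    calc _ ≤ μ s (⋃ s', {ζ | (∀ i ≤ 0, ζ i = s') ∧ ∃ i, 0 ≤ i ∧ i ≤ 0 + k ∧ ζ i ∈ T}) := by
          refine measure_mono ?_
          rintro ζ ⟨i, hi, hT⟩
          refine Set.mem_iUnion.2 ⟨ζ 0, fun j hj => ?_, i, by omega, by omega, hT⟩
          rw [Nat.le_zero.1 hj]
      _ ≤ ∑ s', μ s {ζ | (∀ i ≤ 0, ζ i = s') ∧ ∃ i, 0 ≤ i ∧ i ≤ 0 + k ∧ ζ i ∈ T} :=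
          measure_iUnion_fintype_le _ _
      _ ≤ ∑ s', μ s {ζ | ∀ i ≤ 0, ζ i = s'} * ENNReal.ofReal (η s') := by
          refine Finset.sum_le_sum fun s' _ => ?_
          refine measure_cylinder_inter_reach_le (p := fun x y => ENNReal.ofReal (P x y))
            (f := fun x => ENNReal.ofReal (η x)) (fun x hx => by simp [hηT x hx])
            (fun x => ?_) (fun n a => ?_) k 0 (fun _ => s')
          · simp only [← ENNReal.ofReal_mul (hP0 _ _)]
            rw [← ENNReal.ofReal_sum_of_nonneg fun y _ => mul_nonneg (hP0 x y) (hη0 y)]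
            exact ENNReal.ofReal_le_ofReal (hpre x)
          · rw [hcyl, hcyl, Finset.prod_range_succ, mul_assoc]
      _ = ENNReal.ofReal (η s) := by
          have hzero (s' : S) : μ s {ζ | ∀ i ≤ 0, ζ i = s'} = if s' = s then 1 else 0 := by
            simpa using hcyl s 0 fun _ => s'
          simp only [hzero]
          simp
  have hunion : {ζ : ℕ → S | ∃ i, ζ i ∈ T} = ⋃ k, {ζ | ∃ i ≤ k, ζ i ∈ T} := by
    ext ζ
    simp only [Set.mem_ofPred_eq, Set.mem_iUnion]
    exact ⟨fun ⟨i, hi⟩ => ⟨i, i, le_rfl, hi⟩, fun ⟨_, i, _, hi⟩ => ⟨i, hi⟩⟩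
  have hmono : Monotone fun k : ℕ => {ζ : ℕ → S | ∃ i ≤ k, ζ i ∈ T} :=
    fun k l hkl ζ ⟨i, hi, hT⟩ => ⟨i, hi.trans hkl, hT⟩
  rw [hunion, hmono.measure_iUnion]
  exact iSup_le hreach
end

section
/- Let d ≥ 1, let c : Fin d → ℝ, and let C = {x ∈ stdSimplex ℝ (Fin d) | Σ_{a} c a * x a ≥ 0}. Then every extreme point of C lies on a segment between two (possibly equal) standard basis vectors: for every x in the set of extreme points of C there exist indices i, j ∈ Fin d and λ ∈ [0,1] such that x = λ • e_i + (1−λ) • e_j, where e_k denotes the function that is 1 at k and 0 elsewhere. -/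
open Filter Topology in
/-- A direction vanishing wherever `x ≥ 0` vanishes can be scaled so as to be dominated by `x`. -/
lemma exists_pos_mul_abs_le {ι : Type*} [Finite ι] {x v : ι → ℝ} (hx : ∀ a, 0 ≤ x a)
    (hv : ∀ a, x a = 0 → v a = 0) : ∃ ε : ℝ, 0 < ε ∧ ∀ a, ε * |v a| ≤ x a := by
  have h : ∀ᶠ ε : ℝ in 𝓝[>] 0, ∀ a, ε * |v a| ≤ x a := by
    refine eventually_all.2 fun a => ?_
    rcases (hx a).eq_or_lt with h0 | h0
    · simp [hv a h0.symm, hx a]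
    · have ht : Tendsto (fun ε : ℝ => ε * |v a|) (𝓝[>] 0) (𝓝 0) := by
        have hc : Continuous fun ε : ℝ => ε * |v a| := by fun_prop
        simpa using (hc.tendsto 0).mono_left nhdsWithin_le_nhds
      exact (ht.eventually (gt_mem_nhds h0)).mono fun _ => le_of_lt
  obtain ⟨ε, hε, hpos⟩ := (h.and self_mem_nhdsWithin).exists
  exact ⟨ε, hpos, hε⟩

/-- At an extreme point `x` of the intersection of the simplex with a half-space, no nonzero
direction supported on the support of `x` preserves both linear functionals. -/
lemma eq_zero_of_mem_extremePoints {ι : Type*} [Fintype ι] {c x v : ι → ℝ}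
    (hx : x ∈ Set.extremePoints ℝ {x ∈ stdSimplex ℝ ι | 0 ≤ ∑ a, c a * x a})
    (hv : ∀ a, x a = 0 → v a = 0) (hsum : ∑ a, v a = 0) (hc : ∑ a, c a * v a = 0) :
    v = 0 := by
  obtain ⟨⟨⟨hx0, hx1⟩, hcx⟩, hext⟩ := hx
  obtain ⟨ε, hε, hle⟩ := exists_pos_mul_abs_le hx0 hv
  have hmem : ∀ t : ℝ, |t| = ε →
      x + t • v ∈ {x ∈ stdSimplex ℝ ι | 0 ≤ ∑ a, c a * x a} := by
    intro t ht
    refine ⟨⟨fun a => ?_, ?_⟩, ?_⟩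
    · have h1 := hle a
      rw [← ht, ← abs_mul] at h1
      have h2 := neg_abs_le (t * v a)
      simp only [Pi.add_apply, Pi.smul_apply, smul_eq_mul]
      linarith
    · simp [Finset.sum_add_distrib, ← Finset.mul_sum, hsum, hx1]
    · have h : ∑ a, c a * (x + t • v) a = ∑ a, c a * x a + t * ∑ a, c a * v a := by
        rw [Finset.mul_sum, ← Finset.sum_add_distrib]
        refine Finset.sum_congr rfl fun a _ => ?_
        simp only [Pi.add_apply, Pi.smul_apply, smul_eq_mul]
        ring
      rw [h, hc]
      simpa using hcx
  have hseg : x ∈ openSegment ℝ (x + ε • v) (x + (-ε) • v) := by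
    refine ⟨1 / 2, 1 / 2, by norm_num, by norm_num, by norm_num, ?_⟩
    module
  have h := hext (hmem ε (abs_of_pos hε)) (hmem (-ε) (by rw [abs_neg, abs_of_pos hε])) hseg
  simpa [hε.ne'] using h

/-- An extreme point of the intersection of the simplex with a half-space has at most two
nonzero coordinates. -/
lemma apply_eq_zero_of_mem_extremePoints {ι : Type*} [Fintype ι] [DecidableEq ι] {c x : ι → ℝ}
    (hx : x ∈ Set.extremePoints ℝ {x ∈ stdSimplex ℝ ι | 0 ≤ ∑ a, c a * x a})
    {i j k : ι} (hij : i ≠ j) (hik : i ≠ k) (hjk : j ≠ k) (hi : x i ≠ 0) (hj : x j ≠ 0) :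
    x k = 0 := by
  by_contra hk
  have key : ∀ p q r : ℝ, p + q + r = 0 → c i * p + c j * q + c k * r = 0 →
      p = 0 ∧ q = 0 := by
    intro p q r h1 h2
    have hv := eq_zero_of_mem_extremePoints (v := Pi.single i p + Pi.single j q + Pi.single k r)
      hx ?_ ?_ ?_
    · have hvi := congrFun hv i
      have hvj := congrFun hv j
      simp_all
    · intro a ha
      have hai : a ≠ i := by rintro rfl; exact hi ha
      have haj : a ≠ j := by rintro rfl; exact hj ha
      have hak : a ≠ k := by rintro rfl; exact hk ha
      simp [hai, haj, hak]
    · simpa [Finset.sum_add_distrib] using h1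
    · simpa [mul_add, Finset.sum_add_distrib, Pi.single_apply] using h2
  obtain ⟨h1, h2⟩ := key (c j - c k) (c k - c i) (c i - c j) (by ring) (by ring)
  have h3 := (key 1 (-1) 0 (by ring) (by linarith)).1
  exact one_ne_zero h3

/-- Every extreme point of the intersection of the standard simplex with the half-space
`{x | ∑ a, c a * x a ≥ 0}` lies on a segment between two (possibly equal) standard basis
vectors. -/
theorem extremePoints_mem_segment_basis (d : ℕ) (hd : 1 ≤ d) (c : Fin d → ℝ) :
    ∀ x ∈ Set.extremePoints ℝ
        {x ∈ stdSimplex ℝ (Fin d) | 0 ≤ ∑ a : Fin d, c a * x a},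
      ∃ (i j : Fin d) (l : ℝ), l ∈ Set.Icc (0 : ℝ) 1 ∧
        x = l • (Pi.single i 1 : Fin d → ℝ) + (1 - l) • (Pi.single j 1 : Fin d → ℝ) := by
  intro x hx
  obtain ⟨hx0, hx1⟩ := hx.1.1
  obtain ⟨i, -, hi⟩ : ∃ i ∈ Finset.univ, x i ≠ 0 :=
    Finset.exists_ne_zero_of_sum_ne_zero (by rw [hx1]; exact one_ne_zero)
  by_cases h : ∃ j, j ≠ i ∧ x j ≠ 0
  · obtain ⟨j, hji, hj⟩ := h
    have hz : ∀ k, k ≠ i ∧ k ≠ j → x k = 0 := fun k hk =>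
      apply_eq_zero_of_mem_extremePoints hx hji.symm hk.1.symm hk.2.symm hi hj
    have hs : x i + x j = 1 := by rw [← hx1, Fintype.sum_eq_add i j hji.symm hz]
    refine ⟨i, j, x i, ⟨hx0 i, by linarith [hx0 j]⟩, funext fun k => ?_⟩
    by_cases hki : k = i
    · subst hki
      simp [hji.symm]
    by_cases hkj : k = j
    · subst hkj
      simp [hji, ← eq_sub_of_add_eq' hs]
    simp [hki, hkj, hz k ⟨hki, hkj⟩]
  · push Not at h
    have hs : x i = 1 := by rw [← hx1, Fintype.sum_eq_single i h]
    refine ⟨i, i, 1, by simp, funext fun k => ?_⟩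
    by_cases hki : k = i
    · subst hki
      simp [hs]
    simp [hki, h k hki]
end

section
/- Let d ≥ 1, let c : Fin d → ℝ, and let C = {x ∈ stdSimplex ℝ (Fin d) | Σ_{a} c a * x a ≥ 0}. Let i, j ∈ Fin d with i ≠ j, c i < 0, and c j ≥ 0, and let λ_max be the supremum of {λ ∈ [0,1] | λ * c i + (1−λ) * c j ≥ 0} (explicitly, λ_max = c j / (c j − c i)). Then the point x = λ_max • e_i + (1−λ_max) • e_j is an extreme point of C, where e_k denotes the function that is 1 at k and 0 elsewhere. -/
/-- A point of the simplex supported on `{i, j}` and satisfying the half-space constraint has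
`i`-th coordinate at most `c j / (c j - c i)`. -/
theorem apply_le_of_mem_stdSimplex_of_support {ι : Type*} [Fintype ι] {c y : ι → ℝ} {i j : ι}
    (hij : i ≠ j) (hc : c i < c j) (hy : y ∈ stdSimplex ℝ ι) (hcy : 0 ≤ ∑ a, c a * y a)
    (h0 : ∀ a, a ≠ i ∧ a ≠ j → y a = 0) : y i ≤ c j / (c j - c i) := by
  have hs := hy.2
  rw [Fintype.sum_eq_add i j hij h0] at hs
  rw [Fintype.sum_eq_add i j hij fun a ha => by rw [h0 a ha, mul_zero]] at hcy
  rw [le_div_iff₀ (sub_pos.2 hc)]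
  have hj : y j = 1 - y i := by linarith
  rw [hj] at hcy
  linarith

/-- If the basis vector `e i` violates the half-space constraint (`c i < 0`) while `e j`
satisfies it (`c j ≥ 0`), then the point `λ_max • e i + (1 - λ_max) • e j`, where
`λ_max = c j / (c j - c i)` is the supremum of `{λ ∈ [0,1] | λ * c i + (1-λ) * c j ≥ 0}`,
is an extreme point (a vertex) of the polytope obtained by intersecting the standard
simplex with the half-space `{x | ∑ a, c a * x a ≥ 0}`. -/
theorem boundary_point_extreme (d : ℕ) (hd : 1 ≤ d) (c : Fin d → ℝ)
    (i j : Fin d) (hij : i ≠ j) (hci : c i < 0) (hcj : 0 ≤ c j)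
    (lmax : ℝ) (hlmax : lmax = c j / (c j - c i)) :
    lmax • (Pi.single i 1 : Fin d → ℝ) + (1 - lmax) • (Pi.single j 1 : Fin d → ℝ) ∈
      Set.extremePoints ℝ
        {x ∈ stdSimplex ℝ (Fin d) | 0 ≤ ∑ a : Fin d, c a * x a} := by
  have hpos : 0 < c j - c i := by linarith
  have hl0 : 0 ≤ lmax := hlmax ▸ div_nonneg hcj hpos.le
  have hl1 : lmax ≤ 1 := by rw [hlmax, div_le_one hpos]; linarith
  have hlc : c i * lmax + c j * (1 - lmax) = 0 := by rw [hlmax]; field_simp; ring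
  set x : Fin d → ℝ := lmax • (Pi.single i 1 : Fin d → ℝ) + (1 - lmax) • Pi.single j 1 with hx
  have hxi : x i = lmax := by simp [hx, hij]
  have hxj : x j = 1 - lmax := by simp [hx, hij.symm]
  have hx0 : ∀ a, a ≠ i ∧ a ≠ j → x a = 0 := fun a ha => by simp [hx, ha.1, ha.2]
  refine ⟨⟨⟨fun a => ?_, ?_⟩, ?_⟩, ?_⟩
  · by_cases hai : a = i
    · rw [hai, hxi]; exact hl0
    by_cases haj : a = j
    · rw [haj, hxj]; linarith
    · exact (hx0 a ⟨hai, haj⟩).ge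
  · rw [Fintype.sum_eq_add i j hij hx0, hxi, hxj]; ring
  · rw [Fintype.sum_eq_add i j hij fun a ha => by rw [hx0 a ha, mul_zero], hxi, hxj, hlc]
  rintro y ⟨hy, hcy⟩ z ⟨hz, hcz⟩ ⟨p, q, hp, hq, hpq, hyz⟩
  have hcoord : ∀ a, p * y a + q * z a = x a := fun a => by rw [← hyz]; simp
  have hy0 : ∀ a, a ≠ i ∧ a ≠ j → y a = 0 := fun a ha => by
    nlinarith [hcoord a, hx0 a ha, hy.1 a, mul_nonneg hq.le (hz.1 a), mul_nonneg hp.le (hy.1 a)]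
  have hz0 : ∀ a, a ≠ i ∧ a ≠ j → z a = 0 := fun a ha => by
    nlinarith [hcoord a, hx0 a ha, hz.1 a, mul_nonneg hq.le (hz.1 a), mul_nonneg hp.le (hy.1 a)]
  have hyi : y i ≤ lmax :=
    hlmax ▸ apply_le_of_mem_stdSimplex_of_support hij (sub_pos.1 hpos) hy hcy hy0
  have hzi : z i ≤ lmax :=
    hlmax ▸ apply_le_of_mem_stdSimplex_of_support hij (sub_pos.1 hpos) hz hcz hz0
  have hyi_eq : y i = lmax := by
    refine hyi.antisymm (le_of_mul_le_mul_left ?_ hp)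
    have hqz := mul_le_mul_of_nonneg_left hzi hq.le
    have hsum : p * lmax + q * lmax = lmax := by rw [← add_mul, hpq, one_mul]
    linarith [hcoord i]
  have hyj : y j = 1 - lmax := by
    have hs := hy.2
    rw [Fintype.sum_eq_add i j hij hy0] at hs
    linarith
  funext a
  by_cases hai : a = i
  · rw [hai, hyi_eq, hxi]
  by_cases haj : a = j
  · rw [haj, hyj, hxj]
  · rw [hy0 a ⟨hai, haj⟩, hx0 a ⟨hai, haj⟩]
end

section
/- Let d ≥ 1, let c : Fin d → ℝ, let a* ∈ Fin d be an index with c a* = min_{a} c a, let ω ≥ 0, let q ∈ ℝ, and let v ∈ stdSimplex ℝ (Fin d) satisfy Σ_a v a * c a ≤ q. Define v' : Fin d → ℝ by v' a* = v a* + Σ_{a ≠ a*, v a ≤ ω} v a; v' a = 0 for a ≠ a* with v a ≤ ω; and v' a = v a for a ≠ a* with v a > ω. Then (i) v' ∈ stdSimplex ℝ (Fin d); (ii) Σ_a v' a * c a ≤ Σ_a v a * c a ≤ q; and (iii) the total redistributed mass satisfies Σ_{a ≠ a*, v a ≤ ω} v a ≤ ω * (d − 1), so that Σ_a |v a − v'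 a| ≤ 2 * ω * (d − 1). -/
open Finset
open scoped Classical

/-- The mass-shifting construction in the proof of Theorem 2, item 3: moving all the mass
of `v` sitting on coordinates `a ≠ a*` with `v a ≤ ω` onto a minimizing coordinate `a*` of
`c` yields a distribution `v'` that (i) is still in the simplex, (ii) has a one-step
expected safety cost no larger than that of `v` (hence still at most `q`), and (iii)
moves total mass at most `ω * (d - 1)`, so that `∑ a, |v a - v' a| ≤ 2 * ω * (d - 1)`. -/
theorem mass_shift (d : ℕ) (hd : 1 ≤ d) (c : Fin d → ℝ)
    (astar : Fin d) (hmin : ∀ a, c astar ≤ c a)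
    (ω : ℝ) (hω : 0 ≤ ω) (q : ℝ)
    (v : Fin d → ℝ) (hv : v ∈ stdSimplex ℝ (Fin d))
    (hvq : ∑ a : Fin d, v a * c a ≤ q)
    (v' : Fin d → ℝ)
    (hv' : ∀ a, v' a =
      if a = astar then
        v astar + ∑ b ∈ univ.filter (fun b => b ≠ astar ∧ v b ≤ ω), v b
      else if v a ≤ ω then 0 else v a) :
    v' ∈ stdSimplex ℝ (Fin d) ∧
    (∑ a : Fin d, v' a * c a ≤ ∑ a : Fin d, v a * c a ∧
      ∑ a : Fin d, v a * c a ≤ q) ∧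
    (∑ b ∈ univ.filter (fun b => b ≠ astar ∧ v b ≤ ω), v b ≤ ω * ((d : ℝ) - 1)) ∧
    ∑ a : Fin d, |v a - v' a| ≤ 2 * ω * ((d : ℝ) - 1) := by
  set M := ∑ b ∈ univ.filter (fun b => b ≠ astar ∧ v b ≤ ω), v b with hM
  obtain ⟨hv0, hv1⟩ := hv
  -- `w` is the mass removed from each coordinate.
  obtain ⟨w, hw⟩ : ∃ w : Fin d → ℝ, ∀ a, w a = if a ≠ astar ∧ v a ≤ ω then v a else 0 :=
    ⟨_, fun _ => rfl⟩
  have hMw : M = ∑ a, w a := by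
    rw [hM, sum_filter]
    exact sum_congr rfl fun a _ => (hw a).symm
  have hw0 : ∀ a, 0 ≤ w a := fun a => by
    rw [hw]
    split_ifs
    exacts [hv0 a, le_rfl]
  have hM0 : 0 ≤ M := hMw ▸ sum_nonneg fun a _ => hw0 a
  have hshift : ∀ a, v' a = v a - w a + if a = astar then M else 0 := fun a => by
    rw [hv', hw]
    by_cases ha : a = astar
    · simp [ha]
    · by_cases hva : v a ≤ ω <;> simp [ha, hva]
  have hbound : M ≤ ω * ((d : ℝ) - 1) := by
    have hle : ∀ a, w a ≤ ω - if a = astar then ω else 0 := fun a => by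
      rw [hw]
      by_cases ha : a = astar
      · simp [ha]
      · by_cases hva : v a ≤ ω <;> simp [ha, hva, hω]
    calc M = ∑ a, w a := hMw
      _ ≤ ∑ a, (ω - if a = astar then ω else 0) := sum_le_sum fun a _ => hle a
      _ = ω * ((d : ℝ) - 1) := by
        simp [sum_sub_distrib]
        ring
  refine ⟨⟨fun a => ?_, ?_⟩, ⟨?_, hvq⟩, hbound, ?_⟩
  · rw [hv']
    split_ifs with ha hva
    exacts [add_nonneg (hv0 astar) hM0, le_rfl, hv0 a]
  · simp [hshift, sum_add_distrib, sum_sub_distrib, hv1, ← hMw]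
  · have hcost : M * c astar ≤ ∑ a, w a * c a := by
      rw [hMw, sum_mul]
      exact sum_le_sum fun a _ => mul_le_mul_of_nonneg_left (hmin a) (hw0 a)
    have hsum : ∑ a, v' a * c a = ∑ a, v a * c a - ∑ a, w a * c a + M * c astar := by
      simp [hshift, add_mul, sub_mul, sum_add_distrib, sum_sub_distrib]
    linarith
  · have habs : ∀ a, |v a - v' a| ≤ w a + if a = astar then M else 0 := fun a => by
      have hwa := hw0 a
      rw [hshift, abs_le]
      split_ifs <;> constructor <;> linarith
    calc ∑ a, |v a - v' a| ≤ ∑ a, (w a + if a = astar then M else 0) :=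
          sum_le_sum fun a _ => habs a
      _ = M + M := by simp [sum_add_distrib, ← hMw]
      _ ≤ 2 * ω * ((d : ℝ) - 1) := by linarith
end

section
/- Let S be a nonempty finite set, let P, Q : S → S → ℝ be row-stochastic matrices, let ρ ≥ 0 be such that Σ_{s'} |P s s' − Q s s'| ≤ 2ρ for every s ∈ S, let γ ∈ (0,1), let R : S → ℝ, and let r_min, r_max ∈ ℝ be such that r_min ≤ R s ≤ r_max for all s ∈ S. Then for every probability vector μ : S → ℝ, |Σ_{n ∈ ℕ} γⁿ * (Σ_s (μ ⬝ Pⁿ) s * R s − Σ_s (μ ⬝ Qⁿ) s * R s)| ≤ γ * ρ * (r_max − r_min) / (1 − γ)², where μ ⬝ Pⁿ denotes the row vector μ multiplied by the n-th matrix power of P (both series converge absolutely). -/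
open Finset Matrix

/-- The `ℓ¹` norm of `v ᵥ* A` is at most that of `v` times a bound on the `ℓ¹` norms of the rows
of `A`. -/
lemma sum_abs_vecMul_le {m n : Type*} [Fintype m] [Fintype n] (A : Matrix m n ℝ) {c : ℝ}
    (hA : ∀ i, ∑ j, |A i j| ≤ c) (v : m → ℝ) :
    ∑ j, |(v ᵥ* A) j| ≤ c * ∑ i, |v i| :=
  calc ∑ j, |(v ᵥ* A) j| ≤ ∑ j, ∑ i, |v i| * |A i j| := by
        refine sum_le_sum fun j _ => ?_
        simp only [vecMul, dotProduct, ← abs_mul]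
        exact abs_sum_le_sum_abs _ _
    _ = ∑ i, |v i| * ∑ j, |A i j| := by
        rw [sum_comm]
        simp only [mul_sum]
    _ ≤ ∑ i, |v i| * c :=
        sum_le_sum fun i _ => mul_le_mul_of_nonneg_left (hA i) (abs_nonneg _)
    _ = c * ∑ i, |v i| := by rw [← sum_mul, mul_comm]

section Stochastic

variable {S : Type*} [Fintype S] [DecidableEq S]

lemma sum_abs_row_of_mem_rowStochastic {P : Matrix S S ℝ} (hP : P ∈ rowStochastic ℝ S) (s : S) :
    ∑ s', |P s s'| = 1 := by
  rw [← sum_row_of_mem_rowStochastic hP s]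
  exact sum_congr rfl fun s' _ => abs_of_nonneg (nonneg_of_mem_rowStochastic hP)

lemma sum_vecMul_of_mem_rowStochastic {P : Matrix S S ℝ} (hP : P ∈ rowStochastic ℝ S)
    (v : S → ℝ) : ∑ s, (v ᵥ* P) s = ∑ s, v s := by
  simp only [vecMul, dotProduct]
  rw [sum_comm]
  simp only [← mul_sum, sum_row_of_mem_rowStochastic hP, mul_one]

lemma sum_abs_vecMul_le_of_mem_rowStochastic {P : Matrix S S ℝ} (hP : P ∈ rowStochastic ℝ S)
    (v : S → ℝ) : ∑ s, |(v ᵥ* P) s| ≤ ∑ s, |v s| := by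
  simpa using sum_abs_vecMul_le P (fun s => (sum_abs_row_of_mem_rowStochastic hP s).le) v

/-- If the rows of two stochastic matrices are `c`-close in `ℓ¹`, then the `n`-step images of `v`
are `n c ‖v‖₁`-close in `ℓ¹`. -/
lemma sum_abs_vecMul_pow_sub_le {P Q : Matrix S S ℝ} (hP : P ∈ rowStochastic ℝ S)
    (hQ : Q ∈ rowStochastic ℝ S) {c : ℝ} (hc : 0 ≤ c)
    (hPQ : ∀ s, ∑ s', |P s s' - Q s s'| ≤ c) (v : S → ℝ) (n : ℕ) :
    ∑ s, |(v ᵥ* P ^ n) s - (v ᵥ* Q ^ n) s| ≤ n * (c * ∑ s, |v s|) := by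
  induction n with
  | zero => simp
  | succ n ih =>
    have hsplit : v ᵥ* P ^ (n + 1) - v ᵥ* Q ^ (n + 1) =
        (v ᵥ* P ^ n - v ᵥ* Q ^ n) ᵥ* P + (v ᵥ* Q ^ n) ᵥ* (P - Q) := by
      simp only [pow_succ, ← vecMul_vecMul, sub_vecMul, vecMul_sub]
      abel
    calc ∑ s, |(v ᵥ* P ^ (n + 1)) s - (v ᵥ* Q ^ (n + 1)) s|
        = ∑ s, |((v ᵥ* P ^ n - v ᵥ* Q ^ n) ᵥ* P) s + ((v ᵥ* Q ^ n) ᵥ* (P - Q)) s| :=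
          sum_congr rfl fun s _ => congrArg _ (congrFun hsplit s)
      _ ≤ ∑ s, |((v ᵥ* P ^ n - v ᵥ* Q ^ n) ᵥ* P) s| + ∑ s, |((v ᵥ* Q ^ n) ᵥ* (P - Q)) s| := by
          rw [← sum_add_distrib]
          exact sum_le_sum fun s _ => abs_add_le _ _
      _ ≤ ∑ s, |(v ᵥ* P ^ n - v ᵥ* Q ^ n) s| + c * ∑ s, |(v ᵥ* Q ^ n) s| :=
          add_le_add (sum_abs_vecMul_le_of_mem_rowStochastic hP _)
            (sum_abs_vecMul_le (P - Q) hPQ _)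
      _ ≤ n * (c * ∑ s, |v s|) + c * ∑ s, |v s| :=
          add_le_add ih (mul_le_mul_of_nonneg_left
            (sum_abs_vecMul_le_of_mem_rowStochastic (pow_mem hQ n) v) hc)
      _ = (n + 1 : ℕ) * (c * ∑ s, |v s|) := by
          push_cast
          ring

lemma summable_pow_mul_sum_vecMul_pow {P : Matrix S S ℝ} (hP : P ∈ rowStochastic ℝ S) {γ : ℝ}
    (h0 : 0 ≤ γ) (h1 : γ < 1) (v R : S → ℝ) :
    Summable (fun n : ℕ => γ ^ n * ∑ s, (v ᵥ* P ^ n) s * R s) := by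
  refine Summable.of_norm_bounded
    ((summable_geometric_of_lt_one h0 h1).mul_right ((∑ s, |v s|) * ‖R‖)) fun n => ?_
  rw [norm_mul, Real.norm_eq_abs, abs_of_nonneg (pow_nonneg h0 n), Real.norm_eq_abs]
  refine mul_le_mul_of_nonneg_left ?_ (pow_nonneg h0 n)
  calc |∑ s, (v ᵥ* P ^ n) s * R s| ≤ ∑ s, |(v ᵥ* P ^ n) s * R s| := abs_sum_le_sum_abs _ _
    _ ≤ ∑ s, |(v ᵥ* P ^ n) s| * ‖R‖ := by
        refine sum_le_sum fun s _ => ?_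
        rw [abs_mul]
        exact mul_le_mul_of_nonneg_left (norm_le_pi_norm R s) (abs_nonneg _)
    _ ≤ (∑ s, |v s|) * ‖R‖ := by
        rw [← sum_mul]
        exact mul_le_mul_of_nonneg_right
          (sum_abs_vecMul_le_of_mem_rowStochastic (pow_mem hP n) v) (norm_nonneg R)

end Stochastic

/-- Pairing a vector of total mass zero with a function of oscillation at most `b - a`. -/
lemma abs_sum_mul_le_of_sum_eq_zero {S : Type*} [Fintype S] {w R : S → ℝ} {a b : ℝ}
    (hw : ∑ s, w s = 0) (hR : ∀ s, a ≤ R s ∧ R s ≤ b) :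
    |∑ s, w s * R s| ≤ (∑ s, |w s|) * ((b - a) / 2) := by
  have hcenter : ∑ s, w s * R s = ∑ s, w s * (R s - (a + b) / 2) := by
    simp only [mul_sub, sum_sub_distrib, ← sum_mul, hw, zero_mul, sub_zero]
  rw [hcenter, sum_mul]
  refine (abs_sum_le_sum_abs _ _).trans (sum_le_sum fun s _ => ?_)
  rw [abs_mul]
  refine mul_le_mul_of_nonneg_left (abs_le.2 ?_) (abs_nonneg _)
  constructor <;> linarith [(hR s).1, (hR s).2]

/-- Reward-perturbation bound used in the proof of Theorem 2, item 3: if two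
row-stochastic matrices `P` and `Q` are within total-variation distance `2ρ` in every
row, `γ ∈ (0,1)` and `r_min ≤ R ≤ r_max`, then the expected `γ`-discounted cumulative
rewards of the two chains (both series converging absolutely) differ by at most
`γ ρ (r_max - r_min) / (1 - γ)²`. -/
theorem discounted_reward_close {S : Type*} [Fintype S] [DecidableEq S] [Nonempty S]
    (P Q : Matrix S S ℝ)
    (hP0 : ∀ s s', 0 ≤ P s s') (hP1 : ∀ s, ∑ s' : S, P s s' = 1)
    (hQ0 : ∀ s s', 0 ≤ Q s s') (hQ1 : ∀ s, ∑ s' : S, Q s s' = 1)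
    (ρ : ℝ) (hρ : 0 ≤ ρ)
    (hPQ : ∀ s, ∑ s' : S, |P s s' - Q s s'| ≤ 2 * ρ)
    (γ : ℝ) (hγ : γ ∈ Set.Ioo (0 : ℝ) 1)
    (R : S → ℝ) (rmin rmax : ℝ) (hR : ∀ s, rmin ≤ R s ∧ R s ≤ rmax)
    (μ : S → ℝ) (hμ0 : ∀ s, 0 ≤ μ s) (hμ1 : ∑ s : S, μ s = 1) :
    Summable (fun n : ℕ => γ ^ n * ∑ s : S, (μ ᵥ* (P ^ n)) s * R s) ∧
    Summable (fun n : ℕ => γ ^ n * ∑ s : S, (μ ᵥ* (Q ^ n)) s * R s) ∧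
    |∑' n : ℕ, γ ^ n *
        (∑ s : S, (μ ᵥ* (P ^ n)) s * R s - ∑ s : S, (μ ᵥ* (Q ^ n)) s * R s)| ≤
      γ * ρ * (rmax - rmin) / (1 - γ) ^ 2 := by
  have hP : P ∈ rowStochastic ℝ S := mem_rowStochastic_iff_sum.2 ⟨hP0, hP1⟩
  have hQ : Q ∈ rowStochastic ℝ S := mem_rowStochastic_iff_sum.2 ⟨hQ0, hQ1⟩
  obtain ⟨hγ0, hγ1⟩ := hγ
  refine ⟨summable_pow_mul_sum_vecMul_pow hP hγ0.le hγ1 μ R,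
    summable_pow_mul_sum_vecMul_pow hQ hγ0.le hγ1 μ R, ?_⟩
  have hμ : ∑ s, |μ s| = 1 := by simpa only [abs_of_nonneg (hμ0 _)] using hμ1
  have hr : rmin ≤ rmax := let ⟨s⟩ := ‹Nonempty S›; (hR s).1.trans (hR s).2
  have hstep (n : ℕ) :
      |∑ s, (μ ᵥ* P ^ n) s * R s - ∑ s, (μ ᵥ* Q ^ n) s * R s| ≤ n * (ρ * (rmax - rmin)) := by
    simp only [← sum_sub_distrib, ← sub_mul]
    have hmass : ∑ s, ((μ ᵥ* P ^ n) s - (μ ᵥ* Q ^ n) s) = 0 := by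
      rw [sum_sub_distrib, sum_vecMul_of_mem_rowStochastic (pow_mem hP n),
        sum_vecMul_of_mem_rowStochastic (pow_mem hQ n), sub_self]
    have hdist := sum_abs_vecMul_pow_sub_le hP hQ (by positivity) hPQ μ n
    rw [hμ] at hdist
    calc _ ≤ _ := abs_sum_mul_le_of_sum_eq_zero hmass hR
      _ ≤ n * (2 * ρ * 1) * ((rmax - rmin) / 2) :=
          mul_le_mul_of_nonneg_right hdist (by linarith)
      _ = n * (ρ * (rmax - rmin)) := by ring
  have hγnorm : ‖γ‖ < 1 := by rwa [Real.norm_eq_abs, abs_of_pos hγ0]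
  have hsum := (hasSum_coe_mul_geometric_of_norm_lt_one hγnorm).mul_right (ρ * (rmax - rmin))
  calc _ ≤ γ / (1 - γ) ^ 2 * (ρ * (rmax - rmin)) := by
        rw [← Real.norm_eq_abs]
        refine tsum_of_norm_bounded hsum fun n => ?_
        rw [norm_mul, norm_pow, Real.norm_eq_abs, Real.norm_eq_abs, abs_of_pos hγ0]
        calc _ ≤ γ ^ n * (n * (ρ * (rmax - rmin))) :=
              mul_le_mul_of_nonneg_left (hstep n) (pow_nonneg hγ0.le n)
          _ = n * γ ^ n * (ρ * (rmax - rmin)) := by ring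
    _ = γ * ρ * (rmax - rmin) / (1 - γ) ^ 2 := by ring
end
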